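/- arXiv:2201.01906 — 2 statements merged into one kernel-verified Lean document; each statement's English description precedes it below -/
import Mathlib

section
/- Let d ≥ 1, let u, B : ℝ^d → ℝ^d be differentiable at a point x, and suppose (∇·u)(x) = 0 and (∇·B)(x) = 0. Then the vector field y ↦ (B(y)·u(y)) B(y) − ½|B(y)|² u(y) is differentiable at x and its divergence at x equals [∇·(B⊗B − ½|B|²𝟙)](x)·u(x) + [∇·(B⊗u)](x)·B(x), where 𝟙 is the d×d identity matrix. In other words, the energy exchanged between the velocity field through the Lorentz force term ∇·(B⊗B − ½|B|²𝟙) and the magnetic field through the coupling term ∇·(B⊗u) is a pure divergence when both fields are divergence-free. -/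
/-- Partial derivative in the `i`-th coordinate direction of a scalar field on `ℝ^d`. -/
noncomputable def pd {d : ℕ} (f : (Fin d → ℝ) → ℝ) (x : Fin d → ℝ) (i : Fin d) : ℝ :=
  fderiv ℝ f x (Pi.single i 1)

/-- Divergence of a vector field on `ℝ^d`. -/
noncomputable def vecDiv {d : ℕ} (u : (Fin d → ℝ) → (Fin d → ℝ)) (x : Fin d → ℝ) : ℝ :=
  ∑ i, pd (fun y => u y i) x i

section PartialDerivative

variable {d : ℕ} {f g : (Fin d → ℝ) → ℝ} {x : Fin d → ℝ}

lemma pd_sub (hf : DifferentiableAt ℝ f x) (hg : DifferentiableAt ℝ g x) (i : Fin d) :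
    pd (fun y => f y - g y) x i = pd f x i - pd g x i := by
  simp [pd, fderiv_fun_sub hf hg]

lemma pd_mul (hf : DifferentiableAt ℝ f x) (hg : DifferentiableAt ℝ g x) (i : Fin d) :
    pd (fun y => f y * g y) x i = pd f x i * g x + f x * pd g x i := by
  simp [pd, fderiv_fun_mul hf hg]
  ring

lemma pd_sum {ι : Type*} {s : Finset ι} {F : ι → (Fin d → ℝ) → ℝ}
    (hF : ∀ k ∈ s, DifferentiableAt ℝ (F k) x) (i : Fin d) :
    pd (fun y => ∑ k ∈ s, F k y) x i = ∑ k ∈ s, pd (F k) x i := by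
  simp [pd, fderiv_fun_sum hF]

lemma pd_ite_zero (p : Prop) [Decidable p] (i : Fin d) :
    pd (fun y => if p then f y else 0) x i = if p then pd f x i else 0 := by
  split_ifs <;> simp [pd]

lemma vecDiv_smul {v : (Fin d → ℝ) → (Fin d → ℝ)} (hf : DifferentiableAt ℝ f x)
    (hv : DifferentiableAt ℝ v x) :
    vecDiv (fun y => f y • v y) x = ∑ i, pd f x i * v x i + f x * vecDiv v x := by
  simp only [vecDiv, Pi.smul_apply, smul_eq_mul, Finset.mul_sum, ← Finset.sum_add_distrib]
  exact Finset.sum_congr rfl fun i _ => pd_mul hf (differentiableAt_pi.1 hv i) i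

lemma vecDiv_sub {v w : (Fin d → ℝ) → (Fin d → ℝ)} (hv : DifferentiableAt ℝ v x)
    (hw : DifferentiableAt ℝ w x) :
    vecDiv (fun y => v y - w y) x = vecDiv v x - vecDiv w x := by
  simp only [vecDiv, Pi.sub_apply, ← Finset.sum_sub_distrib]
  exact Finset.sum_congr rfl fun i _ =>
    pd_sub (differentiableAt_pi.1 hv i) (differentiableAt_pi.1 hw i) i

/-- The divergence of `v ⊗ w`, with the first factor divergence-free, is the derivative of `w`
along `v`. -/
lemma sum_pd_mul_of_vecDiv_eq_zero {v : (Fin d → ℝ) → (Fin d → ℝ)} (hv : DifferentiableAt ℝ v x)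
    (hdiv : vecDiv v x = 0) (hf : DifferentiableAt ℝ f x) :
    ∑ i, pd (fun y => v y i * f y) x i = ∑ i, v x i * pd f x i := by
  have h : ∀ i, pd (fun y => v y i * f y) x i
      = pd (fun y => v y i) x i * f x + v x i * pd f x i :=
    fun i => pd_mul (differentiableAt_pi.1 hv i) hf i
  rw [vecDiv] at hdiv
  simp only [h, Finset.sum_add_distrib, ← Finset.sum_mul, hdiv, zero_mul, zero_add]

end PartialDerivative

theorem stmt_4 {d : ℕ} (hd : 1 ≤ d) (u B : (Fin d → ℝ) → (Fin d → ℝ)) (x : Fin d → ℝ)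
    (hu : DifferentiableAt ℝ u x) (hB : DifferentiableAt ℝ B x)
    (hdivu : vecDiv u x = 0) (hdivB : vecDiv B x = 0) :
    DifferentiableAt ℝ
      (fun y => (∑ k, B y k * u y k) • B y - ((2 : ℝ)⁻¹ * ∑ k, (B y k) ^ 2) • u y) x ∧
    vecDiv (fun y => (∑ k, B y k * u y k) • B y - ((2 : ℝ)⁻¹ * ∑ k, (B y k) ^ 2) • u y) x
      = (∑ j, (∑ i, pd (fun y => B y i * B y j -
            (if i = j then (2 : ℝ)⁻¹ * ∑ k, (B y k) ^ 2 else 0)) x i) * u x j)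
        + ∑ j, (∑ i, pd (fun y => B y i * u y j) x i) * B x j := by
  have hu' : ∀ k, DifferentiableAt ℝ (fun y => u y k) x := differentiableAt_pi.1 hu
  have hB' : ∀ k, DifferentiableAt ℝ (fun y => B y k) x := differentiableAt_pi.1 hB
  have hS : DifferentiableAt ℝ (fun y => ∑ k, B y k * u y k) x :=
    DifferentiableAt.fun_sum fun k _ => (hB' k).fun_mul (hu' k)
  have hq : DifferentiableAt ℝ (fun y => (2 : ℝ)⁻¹ * ∑ k, (B y k) ^ 2) x :=
    (DifferentiableAt.fun_sum fun k _ => (hB' k).fun_pow 2).const_mul _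
  refine ⟨(hS.fun_smul hB).fun_sub (hq.fun_smul hu), ?_⟩
  rw [vecDiv_sub (hS.fun_smul hB) (hq.fun_smul hu), vecDiv_smul hS hB, vecDiv_smul hq hu,
    hdivu, hdivB]
  have hpdS : ∀ i, pd (fun y => ∑ k, B y k * u y k) x i
      = ∑ k, (pd (fun y => B y k) x i * u x k + B x k * pd (fun y => u y k) x i) := fun i => by
    rw [pd_sum fun k _ => (hB' k).fun_mul (hu' k)]
    exact Finset.sum_congr rfl fun k _ => pd_mul (hB' k) (hu' k) i
  have hstress : ∀ j, ∑ i, pd (fun y => B y i * B y j -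
        (if i = j then (2 : ℝ)⁻¹ * ∑ k, (B y k) ^ 2 else 0)) x i
      = ∑ i, B x i * pd (fun y => B y j) x i
        - pd (fun y => (2 : ℝ)⁻¹ * ∑ k, (B y k) ^ 2) x j := fun j => by
    have h : ∀ i, pd (fun y => B y i * B y j -
          (if i = j then (2 : ℝ)⁻¹ * ∑ k, (B y k) ^ 2 else 0)) x i
        = pd (fun y => B y i * B y j) x i
          - if i = j then pd (fun y => (2 : ℝ)⁻¹ * ∑ k, (B y k) ^ 2) x i else 0 := fun i => by
      rw [pd_sub ((hB' i).fun_mul (hB' j)) (by split_ifs <;> fun_prop), pd_ite_zero]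
    simp only [h, Finset.sum_sub_distrib, sum_pd_mul_of_vecDiv_eq_zero hB hdivB (hB' j),
      Finset.sum_ite_eq', Finset.mem_univ, if_true]
  simp only [hpdS, hstress, sum_pd_mul_of_vecDiv_eq_zero hB hdivB (hu' _), sub_mul,
    Finset.sum_sub_distrib, mul_zero, add_zero, Finset.sum_mul, add_mul, Finset.sum_add_distrib]
  rw [Finset.sum_comm, sub_add_eq_add_sub]
  congr 2
  · exact Finset.sum_congr rfl fun j _ => Finset.sum_congr rfl fun i _ => by ring
  · rw [Finset.sum_comm]
    exact Finset.sum_congr rfl fun j _ => Finset.sum_congr rfl fun i _ => by ring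
end

section
/- Let d ≥ 1 and let ρ, μ₀ > 0 be constants, and let ν, η : ℝ^d × ℝ → ℝ be continuously differentiable with ν ≥ 0 and η ≥ 0. Let u, B : ℝ^d × ℝ → ℝ^d be twice continuously differentiable and p, r : ℝ^d × ℝ → ℝ continuously differentiable, satisfying everywhere on ℝ^d × ℝ the incompressible MHD equations with zero forcing: ∂u/∂t + ∇·(u⊗u) + (1/ρ)∇p − ∇·(2ν∇^s u) − ∇·((1/(ρμ₀))(B⊗B − ½|B|²𝟙)) = 0, ∇·u = 0, ∂B/∂t + ∇·(u⊗B) − ∇·(B⊗u) − ∇·(2(η/μ₀)∇^a B) + ∇r = 0, and ∇·B = 0 (spatial operators in x). Suppose there is a compact set K ⊆ ℝ^d such that for every t, the functions u(·,t), B(·,t), p(·,t), and r(·,t) vanish outside K. Then the total energy E(t) = ∫_{ℝ^d} (½ρ|u(x,t)|² + (1/(2μ₀))|B(x,t)|²) dx is nonincreasing in t; indeed for every t, E has derivative −∫_{ℝ^d} (2ρν|∇^s u|² + (2η/μ₀²)|∇^a B|²) dx ≤ 0 at t. -/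
open MeasureTheory

noncomputable section

/-- Spatial partial derivative `∂f/∂x_i` of a scalar field on `ℝ^d × ℝ` (space × time). -/
def spd {d : ℕ} (f : (Fin d → ℝ) × ℝ → ℝ) (z : (Fin d → ℝ) × ℝ) (i : Fin d) : ℝ :=
  fderiv ℝ f z (Pi.single i 1, 0)

/-- Time derivative `∂f/∂t` of a scalar field on `ℝ^d × ℝ` (space × time). -/
def tpd {d : ℕ} (f : (Fin d → ℝ) × ℝ → ℝ) (z : (Fin d → ℝ) × ℝ) : ℝ :=
  fderiv ℝ f z (0, 1)

/-- Spatial divergence `∇·u` of a (time-dependent) vector field. -/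
def sdivVec {d : ℕ} (u : (Fin d → ℝ) × ℝ → Fin d → ℝ) (z : (Fin d → ℝ) × ℝ) : ℝ :=
  ∑ i, spd (fun w => u w i) z i

/-- Spatial divergence of a matrix field, `(∇·A)_j = Σ_i ∂A_{ij}/∂x_i`. -/
def sdivMat {d : ℕ} (A : (Fin d → ℝ) × ℝ → Fin d → Fin d → ℝ) (z : (Fin d → ℝ) × ℝ)
    (j : Fin d) : ℝ :=
  ∑ i, spd (fun w => A w i j) z i

/-- Symmetric (spatial) gradient `(∇^s u)_{ij} = ½(∂u_j/∂x_i + ∂u_i/∂x_j)`. -/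
def sGrad {d : ℕ} (u : (Fin d → ℝ) × ℝ → Fin d → ℝ) (z : (Fin d → ℝ) × ℝ)
    (i j : Fin d) : ℝ :=
  (2 : ℝ)⁻¹ * (spd (fun w => u w j) z i + spd (fun w => u w i) z j)

/-- Antisymmetric (spatial) gradient `(∇^a u)_{ij} = ½(∂u_j/∂x_i - ∂u_i/∂x_j)`. -/
def aGrad {d : ℕ} (u : (Fin d → ℝ) × ℝ → Fin d → ℝ) (z : (Fin d → ℝ) × ℝ)
    (i j : Fin d) : ℝ :=
  (2 : ℝ)⁻¹ * (spd (fun w => u w j) z i - spd (fun w => u w i) z j)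

section Derivatives

variable {d : ℕ} {f g : (Fin d → ℝ) × ℝ → ℝ} {z : (Fin d → ℝ) × ℝ} {i : Fin d}

theorem spd_add (hf : DifferentiableAt ℝ f z) (hg : DifferentiableAt ℝ g z) :
    spd (fun w => f w + g w) z i = spd f z i + spd g z i := by
  simp [spd, fderiv_fun_add hf hg]

theorem spd_sub (hf : DifferentiableAt ℝ f z) (hg : DifferentiableAt ℝ g z) :
    spd (fun w => f w - g w) z i = spd f z i - spd g z i := by
  simp [spd, fderiv_fun_sub hf hg]

theorem spd_mul (hf : DifferentiableAt ℝ f z) (hg : DifferentiableAt ℝ g z) :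
    spd (fun w => f w * g w) z i = f z * spd g z i + g z * spd f z i := by
  simp [spd, fderiv_fun_mul hf hg]

theorem spd_const_mul (c : ℝ) (hf : DifferentiableAt ℝ f z) :
    spd (fun w => c * f w) z i = c * spd f z i := by
  simp [spd, fderiv_const_mul hf]

theorem spd_sum {ι : Type*} {s : Finset ι} {F : ι → (Fin d → ℝ) × ℝ → ℝ}
    (hF : ∀ k ∈ s, DifferentiableAt ℝ (F k) z) :
    spd (fun w => ∑ k ∈ s, F k w) z i = ∑ k ∈ s, spd (F k) z i := by
  simp [spd, fderiv_fun_sum hF]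

theorem fderiv_sum_sq {v : (Fin d → ℝ) × ℝ} {u : (Fin d → ℝ) × ℝ → Fin d → ℝ}
    (hu : ∀ j, DifferentiableAt ℝ (fun w => u w j) z) :
    fderiv ℝ (fun w => ∑ j, (u w j) ^ 2) z v
      = 2 * ∑ j, u z j * fderiv ℝ (fun w => u w j) z v := by
  rw [fderiv_fun_sum (A := fun j w => (u w j) ^ 2) fun j _ => (hu j).pow 2]
  simp only [FunLike.coe_sum, Finset.sum_apply, Finset.mul_sum]
  refine Finset.sum_congr rfl fun j _ => ?_
  rw [fderiv_fun_pow 2 (hu j)]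
  simp [mul_assoc]

theorem ContDiff.spd (hf : ContDiff ℝ 2 f) (i : Fin d) : ContDiff ℝ 1 (fun z => spd f z i) :=
  (hf.fderiv_right (m := 1) (by norm_num)).clm_apply contDiff_const

theorem ContDiff.continuous_spd (hf : ContDiff ℝ 1 f) (i : Fin d) :
    Continuous (fun z => _root_.spd f z i) :=
  (hf.continuous_fderiv (by norm_num)).clm_apply continuous_const

theorem ContDiff.continuous_tpd (hf : ContDiff ℝ 1 f) : Continuous (fun z => tpd f z) :=
  (hf.continuous_fderiv (by norm_num)).clm_apply continuous_const

end Derivatives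

section Divergence

variable {d : ℕ} {v w : (Fin d → ℝ) × ℝ → Fin d → ℝ} {f : (Fin d → ℝ) × ℝ → ℝ}
  {M : (Fin d → ℝ) × ℝ → Fin d → Fin d → ℝ} {z : (Fin d → ℝ) × ℝ}

theorem sum_spd_mul_of_sdivVec_eq_zero (hv : ∀ j, DifferentiableAt ℝ (fun y => v y j) z)
    (hf : DifferentiableAt ℝ f z) (hdiv : sdivVec v z = 0) :
    ∑ i, spd (fun y => v y i * f y) z i = ∑ i, v z i * spd f z i := by
  simp only [spd_mul (hv _) hf, Finset.sum_add_distrib]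
  rw [← Finset.mul_sum, show ∑ i, spd (fun y => v y i) z i = 0 from hdiv]
  ring

theorem sum_mul_sdivMat (hw : ∀ j, DifferentiableAt ℝ (fun y => w y j) z)
    (hM : ∀ i j, DifferentiableAt ℝ (fun y => M y i j) z) :
    ∑ j, w z j * sdivMat M z j
      = ∑ i, spd (fun y => ∑ j, M y i j * w y j) z i
        - ∑ i, ∑ j, M z i j * spd (fun y => w y j) z i := by
  have h : ∀ i, spd (fun y => ∑ j, M y i j * w y j) z i
      = ∑ j, (M z i j * spd (fun y => w y j) z i + w z j * spd (fun y => M y i j) z i) := by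
    intro i
    rw [spd_sum (F := fun j y => M y i j * w y j) fun j _ => (hM i j).mul (hw j)]
    simp only [spd_mul (hM _ _) (hw _)]
  simp only [h, Finset.sum_add_distrib, sdivMat, Finset.mul_sum]
  rw [Finset.sum_comm]
  ring

theorem sdivMat_const_mul (c : ℝ) (hM : ∀ i j, DifferentiableAt ℝ (fun y => M y i j) z)
    (j : Fin d) : sdivMat (fun y i j => c * M y i j) z j = c * sdivMat M z j := by
  simp only [sdivMat, spd_const_mul c (hM _ _), Finset.mul_sum]

theorem sdivMat_sub_diagonal (hM : ∀ i j, DifferentiableAt ℝ (fun y => M y i j) z)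
    (hf : DifferentiableAt ℝ f z) (j : Fin d) :
    sdivMat (fun y i j => M y i j - if i = j then f y else 0) z j
      = sdivMat M z j - spd f z j := by
  have h : ∀ i, spd (fun y => M y i j - if i = j then f y else 0) z i
      = spd (fun y => M y i j) z i - if i = j then spd f z i else 0 := by
    intro i
    by_cases hij : i = j
    · simp only [hij, if_true]
      exact spd_sub (hM j j) hf
    · simp [hij]
  simp [sdivMat, h, Finset.sum_sub_distrib]

theorem sum_sGrad_mul_spd :
    ∑ i, ∑ j, sGrad v z i j * spd (fun y => v y j) z i = ∑ i, ∑ j, (sGrad v z i j) ^ 2 := by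
  have h : ∑ i, ∑ j, sGrad v z i j * spd (fun y => v y j) z i
      = ∑ i, ∑ j, sGrad v z i j * spd (fun y => v y i) z j := by
    rw [Finset.sum_comm]
    simp only [sGrad, add_comm]
  have h' : ∑ i, ∑ j, (sGrad v z i j) ^ 2
      = 2⁻¹ * (∑ i, ∑ j, sGrad v z i j * spd (fun y => v y j) z i
        + ∑ i, ∑ j, sGrad v z i j * spd (fun y => v y i) z j) := by
    simp only [← Finset.sum_add_distrib, Finset.mul_sum]
    refine Finset.sum_congr rfl fun i _ => Finset.sum_congr rfl fun j _ => ?_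
    rw [sGrad]
    ring
  rw [h', ← h]
  ring

theorem sum_aGrad_mul_spd :
    ∑ i, ∑ j, aGrad v z i j * spd (fun y => v y j) z i = ∑ i, ∑ j, (aGrad v z i j) ^ 2 := by
  have h : ∑ i, ∑ j, aGrad v z i j * spd (fun y => v y j) z i
      = -∑ i, ∑ j, aGrad v z i j * spd (fun y => v y i) z j := by
    rw [Finset.sum_comm]
    simp only [← Finset.sum_neg_distrib]
    refine Finset.sum_congr rfl fun i _ => Finset.sum_congr rfl fun j _ => ?_
    simp only [aGrad]
    ring
  have h' : ∑ i, ∑ j, (aGrad v z i j) ^ 2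
      = 2⁻¹ * (∑ i, ∑ j, aGrad v z i j * spd (fun y => v y j) z i
        - ∑ i, ∑ j, aGrad v z i j * spd (fun y => v y i) z j) := by
    simp only [← Finset.sum_sub_distrib, Finset.mul_sum]
    refine Finset.sum_congr rfl fun i _ => Finset.sum_congr rfl fun j _ => ?_
    rw [aGrad]
    ring
  rw [h']
  linarith

end Divergence

section CompactSupport

variable {d : ℕ} {f : (Fin d → ℝ) × ℝ → ℝ} {K : Set (Fin d → ℝ)}

theorem fderiv_eq_zero_of_forall_notMem (hK : IsCompact K)
    (h0 : ∀ t : ℝ, ∀ x, x ∉ K → f (x, t) = 0) {x : Fin d → ℝ} (hx : x ∉ K) (t : ℝ) :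
    fderiv ℝ f (x, t) = 0 := by
  have h : f =ᶠ[nhds (x, t)] fun _ => 0 := by
    filter_upwards [(hK.isClosed.isOpen_compl.preimage continuous_fst).mem_nhds
      (show (x, t) ∈ Prod.fst ⁻¹' Kᶜ from hx)] with y hy
    exact h0 y.2 y.1 hy
  rw [h.fderiv_eq]
  simp

theorem integrable_slice (hf : Continuous f) (hK : IsCompact K)
    (h0 : ∀ t : ℝ, ∀ x, x ∉ K → f (x, t) = 0) (t : ℝ) :
    Integrable (fun x : Fin d → ℝ => f (x, t)) :=
  (hf.comp (by fun_prop : Continuous fun x : Fin d → ℝ => (x, t))).integrable_of_hasCompactSupport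
    (HasCompactSupport.intro hK fun x hx => h0 t x hx)

theorem integrable_spd (hf : ContDiff ℝ 1 f) (hK : IsCompact K)
    (h0 : ∀ t : ℝ, ∀ x, x ∉ K → f (x, t) = 0) (t : ℝ) (i : Fin d) :
    Integrable (fun x : Fin d → ℝ => spd f (x, t) i) :=
  integrable_slice (hf.continuous_spd i) hK
    (fun s x hx => by simp [spd, fderiv_eq_zero_of_forall_notMem hK h0 hx s]) t

theorem integrable_tpd (hf : ContDiff ℝ 1 f) (hK : IsCompact K)
    (h0 : ∀ t : ℝ, ∀ x, x ∉ K → f (x, t) = 0) (t : ℝ) :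
    Integrable (fun x : Fin d → ℝ => tpd f (x, t)) :=
  integrable_slice hf.continuous_tpd hK
    (fun s x hx => by simp [tpd, fderiv_eq_zero_of_forall_notMem hK h0 hx s]) t

theorem integral_spd_eq_zero (hf : ContDiff ℝ 1 f) (hK : IsCompact K)
    (h0 : ∀ t : ℝ, ∀ x, x ∉ K → f (x, t) = 0) (t : ℝ) (i : Fin d) :
    ∫ x : Fin d → ℝ, spd f (x, t) i = 0 := by
  have hd : ∀ x : Fin d → ℝ, HasFDerivAt (fun x => f (x, t))
      ((fderiv ℝ f (x, t)).comp (ContinuousLinearMap.inl ℝ (Fin d → ℝ) ℝ)) x := fun x =>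
    HasFDerivAt.comp x (hf.differentiable one_ne_zero (x, t)).hasFDerivAt
      (hasFDerivAt_prodMk_left x t)
  have hs : ∀ x : Fin d → ℝ,
      fderiv ℝ (fun x => f (x, t)) x (Pi.single i 1) = spd f (x, t) i := by
    intro x
    rw [(hd x).fderiv]
    simp [spd]
  have key := integral_mul_fderiv_eq_neg_fderiv_mul_of_integrable (μ := volume)
    (f := fun _ : Fin d → ℝ => (1 : ℝ)) (g := fun x => f (x, t)) (v := Pi.single i 1)
    (by simp) (by simpa [hs] using integrable_spd hf hK h0 t i)
    (by simpa using integrable_slice hf.continuous hK h0 t)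
    (by fun_prop) (fun x _ => (hd x).differentiableAt)
  simpa [hs] using key

theorem hasDerivAt_integral_slice (hf : ContDiff ℝ 1 f) (hK : IsCompact K)
    (h0 : ∀ t : ℝ, ∀ x, x ∉ K → f (x, t) = 0) (t : ℝ) :
    HasDerivAt (fun t : ℝ => ∫ x : Fin d → ℝ, f (x, t)) (∫ x : Fin d → ℝ, tpd f (x, t)) t := by
  obtain ⟨C, hC⟩ := (hK.prod (isCompact_closedBall t 1)).exists_bound_of_continuousOn
    hf.continuous_tpd.continuousOn
  refine (hasDerivAt_integral_of_dominated_loc_of_deriv_le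
    (F := fun s x => f (x, s)) (F' := fun s x => tpd f (x, s)) (bound := K.indicator fun _ => C)
    (Metric.closedBall_mem_nhds t one_pos) (Filter.Eventually.of_forall fun s =>
      (integrable_slice hf.continuous hK h0 s).aestronglyMeasurable)
    (integrable_slice hf.continuous hK h0 t) (integrable_tpd hf hK h0 t).aestronglyMeasurable
    (Filter.Eventually.of_forall fun x s hs => ?_) ?_
    (Filter.Eventually.of_forall fun x s _ => ?_)).2
  · by_cases hx : x ∈ K
    · simpa [hx] using hC (x, s) ⟨hx, hs⟩
    · simp [hx, tpd, fderiv_eq_zero_of_forall_notMem hK h0 hx s]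
  · rw [integrable_indicator_iff hK.measurableSet]
    exact integrableOn_const hK.measure_ne_top
  · exact HasFDerivAt.comp_hasDerivAt s (hf.differentiable one_ne_zero (x, s)).hasFDerivAt
      ((hasDerivAt_const s x).prodMk (hasDerivAt_id s))

end CompactSupport

section EnergyBalance

variable {d : ℕ}

theorem sum_sum_mul_comm (a : Fin d → ℝ) (g : Fin d → Fin d → ℝ) :
    ∑ j, ∑ i, a i * g i j = ∑ i, a i * ∑ j, g i j := by
  rw [Finset.sum_comm]
  simp only [Finset.mul_sum]

theorem momentum_energy_balance (ρ μ₀ : ℝ) (hρ : 0 < ρ)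
    {ν p : (Fin d → ℝ) × ℝ → ℝ} {u B : (Fin d → ℝ) × ℝ → Fin d → ℝ} {z : (Fin d → ℝ) × ℝ}
    (hu : ∀ j, DifferentiableAt ℝ (fun w => u w j) z)
    (hB : ∀ j, DifferentiableAt ℝ (fun w => B w j) z)
    (hS : ∀ i j, DifferentiableAt ℝ (fun w => 2 * ν w * sGrad u w i j) z)
    (hdivu : sdivVec u z = 0) (hdivB : sdivVec B z = 0)
    (hmom : ∀ j : Fin d,
      tpd (fun w => u w j) z
        + sdivMat (fun w i j' => u w i * u w j') z j
        + ρ⁻¹ * spd p z j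
        - sdivMat (fun w i j' => 2 * ν w * sGrad u w i j') z j
        - sdivMat (fun w i j' => (ρ * μ₀)⁻¹ * (B w i * B w j'
            - (if i = j' then (2 : ℝ)⁻¹ * ∑ k, (B w k) ^ 2 else 0))) z j = 0) :
    ρ * ∑ j, u z j * tpd (fun w => u w j) z
      = -ρ * ∑ i, u z i * ∑ j, u z j * spd (fun w => u w j) z i
        - ∑ i, u z i * spd p z i
        + ρ * ∑ i, spd (fun w => ∑ j, 2 * ν w * sGrad u w i j * u w j) z i
        - 2 * ρ * ν z * ∑ i, ∑ j, (sGrad u z i j) ^ 2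
        + μ₀⁻¹ * ∑ i, B z i * ∑ j, u z j * spd (fun w => B w j) z i
        - μ₀⁻¹ * ∑ i, u z i * ∑ j, B z j * spd (fun w => B w j) z i := by
  have hBsq : DifferentiableAt ℝ (fun w => ∑ k, (B w k) ^ 2) z :=
    DifferentiableAt.fun_sum fun k _ => (hB k).pow 2
  have hsq : ∀ j, spd (fun w => (2 : ℝ)⁻¹ * ∑ k, (B w k) ^ 2) z j
      = ∑ k, B z k * spd (fun w => B w k) z j := by
    intro j
    rw [spd_const_mul _ hBsq, spd, fderiv_sum_sq hB]
    simp only [spd]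
    ring
  have hmax : ∀ j, sdivMat (fun w i j' => (ρ * μ₀)⁻¹ * (B w i * B w j'
      - (if i = j' then (2 : ℝ)⁻¹ * ∑ k, (B w k) ^ 2 else 0))) z j
      = (ρ * μ₀)⁻¹ * (∑ i, B z i * spd (fun w => B w j) z i
        - ∑ k, B z k * spd (fun w => B w k) z j) := by
    intro j
    have hdiag : ∀ i j' : Fin d, DifferentiableAt ℝ
        (fun w => if i = j' then (2 : ℝ)⁻¹ * ∑ k, (B w k) ^ 2 else 0) z := by
      intro i j'
      by_cases h : i = j'
      · simpa [h] using hBsq.const_mul (2 : ℝ)⁻¹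
      · simp [h]
    rw [sdivMat_const_mul _ (fun i j' => ((hB i).fun_mul (hB j')).fun_sub (hdiag i j')),
      sdivMat_sub_diagonal (fun i j' => (hB i).fun_mul (hB j')) (hBsq.const_mul _), hsq]
    congr 2
    exact sum_spd_mul_of_sdivVec_eq_zero hB (hB j) hdivB
  have hadv : ∀ j, sdivMat (fun w i j' => u w i * u w j') z j
      = ∑ i, u z i * spd (fun w => u w j) z i := fun j =>
    sum_spd_mul_of_sdivVec_eq_zero hu (hu j) hdivu
  have hvisc := sum_mul_sdivMat hu hS
  have hdiss : ∑ i, ∑ j, 2 * ν z * sGrad u z i j * spd (fun w => u w j) z i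
      = 2 * ν z * ∑ i, ∑ j, (sGrad u z i j) ^ 2 := by
    rw [← sum_sGrad_mul_spd]
    simp only [Finset.mul_sum, mul_assoc]
  have hpt : ∀ j, ρ * (u z j * tpd (fun w => u w j) z)
      = -ρ * ∑ i, u z i * (u z j * spd (fun w => u w j) z i)
        - u z j * spd p z j
        + ρ * (u z j * sdivMat (fun w i j' => 2 * ν w * sGrad u w i j') z j)
        + μ₀⁻¹ * ∑ i, B z i * (u z j * spd (fun w => B w j) z i)
        - μ₀⁻¹ * (u z j * ∑ k, B z k * spd (fun w => B w k) z j) := by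
    intro j
    have h := hmom j
    rw [hadv, hmax] at h
    have h1 : ∑ i, u z i * (u z j * spd (fun w => u w j) z i)
        = u z j * ∑ i, u z i * spd (fun w => u w j) z i := by
      simp only [Finset.mul_sum, mul_left_comm]
    have h2 : ∑ i, B z i * (u z j * spd (fun w => B w j) z i)
        = u z j * ∑ i, B z i * spd (fun w => B w j) z i := by
      simp only [Finset.mul_sum, mul_left_comm]
    rw [h1, h2]
    have hρρ : ρ * ρ⁻¹ = 1 := mul_inv_cancel₀ hρ.ne'
    rw [mul_inv] at h
    linear_combination (ρ * u z j) * h - (u z j * spd p z j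
      - u z j * μ₀⁻¹ * (∑ i, B z i * spd (fun w => B w j) z i
        - ∑ k, B z k * spd (fun w => B w k) z j)) * hρρ
  have hsum := Finset.sum_congr (rfl : (Finset.univ : Finset (Fin d)) = Finset.univ)
    fun j _ => hpt j
  simp only [Finset.sum_add_distrib, Finset.sum_sub_distrib, ← Finset.mul_sum] at hsum
  rw [hvisc, hdiss, sum_sum_mul_comm, sum_sum_mul_comm] at hsum
  linear_combination hsum

theorem induction_energy_balance (μ₀ : ℝ)
    {η r : (Fin d → ℝ) × ℝ → ℝ} {u B : (Fin d → ℝ) × ℝ → Fin d → ℝ} {z : (Fin d → ℝ) × ℝ}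
    (hu : ∀ j, DifferentiableAt ℝ (fun w => u w j) z)
    (hB : ∀ j, DifferentiableAt ℝ (fun w => B w j) z)
    (hA : ∀ i j, DifferentiableAt ℝ (fun w => 2 * (η w / μ₀) * aGrad B w i j) z)
    (hdivu : sdivVec u z = 0) (hdivB : sdivVec B z = 0)
    (hind : ∀ j : Fin d,
      tpd (fun w => B w j) z
        + sdivMat (fun w i j' => u w i * B w j') z j
        - sdivMat (fun w i j' => B w i * u w j') z j
        - sdivMat (fun w i j' => 2 * (η w / μ₀) * aGrad B w i j') z j
        + spd r z j = 0) :
    ∑ j, B z j * tpd (fun w => B w j) z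
      = -∑ i, u z i * ∑ j, B z j * spd (fun w => B w j) z i
        + ∑ i, B z i * ∑ j, B z j * spd (fun w => u w j) z i
        + ∑ i, spd (fun w => ∑ j, 2 * (η w / μ₀) * aGrad B w i j * B w j) z i
        - 2 * (η z / μ₀) * ∑ i, ∑ j, (aGrad B z i j) ^ 2
        - ∑ i, B z i * spd r z i := by
  have hadv : ∀ j, sdivMat (fun w i j' => u w i * B w j') z j
      = ∑ i, u z i * spd (fun w => B w j) z i := fun j =>
    sum_spd_mul_of_sdivVec_eq_zero hu (hB j) hdivu
  have hstr : ∀ j, sdivMat (fun w i j' => B w i * u w j') z j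
      = ∑ i, B z i * spd (fun w => u w j) z i := fun j =>
    sum_spd_mul_of_sdivVec_eq_zero hB (hu j) hdivB
  have hres := sum_mul_sdivMat hB hA
  have hdiss : ∑ i, ∑ j, 2 * (η z / μ₀) * aGrad B z i j * spd (fun w => B w j) z i
      = 2 * (η z / μ₀) * ∑ i, ∑ j, (aGrad B z i j) ^ 2 := by
    rw [← sum_aGrad_mul_spd]
    simp only [Finset.mul_sum, mul_assoc]
  have hpt : ∀ j, B z j * tpd (fun w => B w j) z
      = B z j * sdivMat (fun w i j' => 2 * (η w / μ₀) * aGrad B w i j') z j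
        - ∑ i, u z i * (B z j * spd (fun w => B w j) z i)
        + ∑ i, B z i * (B z j * spd (fun w => u w j) z i)
        - B z j * spd r z j := by
    intro j
    have h := hind j
    rw [hadv, hstr] at h
    have h1 : ∑ i, u z i * (B z j * spd (fun w => B w j) z i)
        = B z j * ∑ i, u z i * spd (fun w => B w j) z i := by
      simp only [Finset.mul_sum, mul_left_comm]
    have h2 : ∑ i, B z i * (B z j * spd (fun w => u w j) z i)
        = B z j * ∑ i, B z i * spd (fun w => u w j) z i := by
      simp only [Finset.mul_sum, mul_left_comm]
    rw [h1, h2]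
    linear_combination B z j * h
  have hsum := Finset.sum_congr (rfl : (Finset.univ : Finset (Fin d)) = Finset.univ)
    fun j _ => hpt j
  simp only [Finset.sum_add_distrib, Finset.sum_sub_distrib] at hsum
  rw [hres, hdiss, sum_sum_mul_comm, sum_sum_mul_comm] at hsum
  linear_combination hsum

/-- The `i`-th component of the total energy flux of the MHD equations. -/
def energyFlux (ρ μ₀ : ℝ) (ν η p r : (Fin d → ℝ) × ℝ → ℝ) (u B : (Fin d → ℝ) × ℝ → Fin d → ℝ)
    (i : Fin d) (w : (Fin d → ℝ) × ℝ) : ℝ :=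
  (u w i * ((2 : ℝ)⁻¹ * ρ * (∑ j, (u w j) ^ 2) + p w + μ₀⁻¹ * ∑ j, (B w j) ^ 2)
      + B w i * (μ₀⁻¹ * (r w - ∑ j, u w j * B w j)))
    - (ρ * (∑ j, 2 * ν w * sGrad u w i j * u w j)
      + μ₀⁻¹ * ∑ j, 2 * (η w / μ₀) * aGrad B w i j * B w j)

theorem energy_balance (ρ μ₀ : ℝ) (hρ : 0 < ρ)
    {ν η p r : (Fin d → ℝ) × ℝ → ℝ} {u B : (Fin d → ℝ) × ℝ → Fin d → ℝ} {z : (Fin d → ℝ) × ℝ}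
    (hu : ∀ j, DifferentiableAt ℝ (fun w => u w j) z)
    (hB : ∀ j, DifferentiableAt ℝ (fun w => B w j) z)
    (hp : DifferentiableAt ℝ p z) (hr : DifferentiableAt ℝ r z)
    (hS : ∀ i j, DifferentiableAt ℝ (fun w => 2 * ν w * sGrad u w i j) z)
    (hA : ∀ i j, DifferentiableAt ℝ (fun w => 2 * (η w / μ₀) * aGrad B w i j) z)
    (hdivu : sdivVec u z = 0) (hdivB : sdivVec B z = 0)
    (hmom : ∀ j : Fin d,
      tpd (fun w => u w j) z
        + sdivMat (fun w i j' => u w i * u w j') z j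
        + ρ⁻¹ * spd p z j
        - sdivMat (fun w i j' => 2 * ν w * sGrad u w i j') z j
        - sdivMat (fun w i j' => (ρ * μ₀)⁻¹ * (B w i * B w j'
            - (if i = j' then (2 : ℝ)⁻¹ * ∑ k, (B w k) ^ 2 else 0))) z j = 0)
    (hind : ∀ j : Fin d,
      tpd (fun w => B w j) z
        + sdivMat (fun w i j' => u w i * B w j') z j
        - sdivMat (fun w i j' => B w i * u w j') z j
        - sdivMat (fun w i j' => 2 * (η w / μ₀) * aGrad B w i j') z j
        + spd r z j = 0) :
    2 * ρ * ν z * (∑ i, ∑ j, (sGrad u z i j) ^ 2)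
        + (2 * η z / μ₀ ^ 2) * (∑ i, ∑ j, (aGrad B z i j) ^ 2)
      = -tpd (fun w => (2 : ℝ)⁻¹ * ρ * (∑ j, (u w j) ^ 2) + (2 * μ₀)⁻¹ * (∑ j, (B w j) ^ 2)) z
        - ∑ i, spd (energyFlux ρ μ₀ ν η p r u B i) z i := by
  have husq : DifferentiableAt ℝ (fun w => ∑ k, (u w k) ^ 2) z :=
    DifferentiableAt.fun_sum fun k _ => (hu k).pow 2
  have hBsq : DifferentiableAt ℝ (fun w => ∑ k, (B w k) ^ 2) z :=
    DifferentiableAt.fun_sum fun k _ => (hB k).pow 2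
  have huB : DifferentiableAt ℝ (fun w => ∑ k, u w k * B w k) z :=
    DifferentiableAt.fun_sum fun k _ => (hu k).mul (hB k)
  have hSu : ∀ i, DifferentiableAt ℝ (fun w => ∑ j, 2 * ν w * sGrad u w i j * u w j) z :=
    fun i => DifferentiableAt.fun_sum fun j _ => (hS i j).mul (hu j)
  have hAB : ∀ i, DifferentiableAt ℝ (fun w => ∑ j, 2 * (η w / μ₀) * aGrad B w i j * B w j) z :=
    fun i => DifferentiableAt.fun_sum fun j _ => (hA i j).mul (hB j)
  have htime : tpd (fun w => (2 : ℝ)⁻¹ * ρ * (∑ j, (u w j) ^ 2)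
      + (2 * μ₀)⁻¹ * (∑ j, (B w j) ^ 2)) z
      = ρ * (∑ j, u z j * tpd (fun w => u w j) z)
        + μ₀⁻¹ * ∑ j, B z j * tpd (fun w => B w j) z := by
    rw [tpd, fderiv_fun_add (husq.const_mul _) (hBsq.const_mul _), fderiv_const_mul husq,
      fderiv_const_mul hBsq]
    simp only [add_apply, smul_apply, fderiv_sum_sq hu,
      fderiv_sum_sq hB, tpd, smul_eq_mul, mul_inv]
    ring
  have hP : DifferentiableAt ℝ (fun w => (2 : ℝ)⁻¹ * ρ * (∑ j, (u w j) ^ 2) + p w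
      + μ₀⁻¹ * ∑ j, (B w j) ^ 2) z :=
    ((husq.const_mul _).fun_add hp).fun_add (hBsq.const_mul _)
  have hQ : DifferentiableAt ℝ (fun w => μ₀⁻¹ * (r w - ∑ j, u w j * B w j)) z :=
    (hr.fun_sub huB).const_mul _
  have hflux : ∀ i, spd (energyFlux ρ μ₀ ν η p r u B i) z i
      = (spd (fun w => u w i * ((2 : ℝ)⁻¹ * ρ * (∑ j, (u w j) ^ 2) + p w
            + μ₀⁻¹ * ∑ j, (B w j) ^ 2)) z i
          + spd (fun w => B w i * (μ₀⁻¹ * (r w - ∑ j, u w j * B w j))) z i)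
        - (ρ * spd (fun w => ∑ j, 2 * ν w * sGrad u w i j * u w j) z i
          + μ₀⁻¹ * spd (fun w => ∑ j, 2 * (η w / μ₀) * aGrad B w i j * B w j) z i) := by
    intro i
    rw [← spd_const_mul ρ (hSu i), ← spd_const_mul μ₀⁻¹ (hAB i),
      ← spd_add ((hSu i).const_mul _) ((hAB i).const_mul _),
      ← spd_add ((hu i).fun_mul hP) ((hB i).fun_mul hQ),
      ← spd_sub (((hu i).fun_mul hP).fun_add ((hB i).fun_mul hQ))
        (((hSu i).const_mul _).fun_add ((hAB i).const_mul _))]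
    rfl
  have hDP : ∀ i, spd (fun w => (2 : ℝ)⁻¹ * ρ * (∑ j, (u w j) ^ 2) + p w
      + μ₀⁻¹ * ∑ j, (B w j) ^ 2) z i
      = ρ * (∑ j, u z j * spd (fun w => u w j) z i) + spd p z i
        + 2 * μ₀⁻¹ * ∑ j, B z j * spd (fun w => B w j) z i := by
    intro i
    rw [spd_add ((husq.const_mul _).fun_add hp) (hBsq.const_mul _), spd_add (husq.const_mul _) hp,
      spd_const_mul _ husq, spd_const_mul _ hBsq]
    simp only [spd, fderiv_sum_sq hu, fderiv_sum_sq hB]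
    ring
  have hDQ : ∀ i, spd (fun w => μ₀⁻¹ * (r w - ∑ j, u w j * B w j)) z i
      = μ₀⁻¹ * (spd r z i - (∑ j, u z j * spd (fun w => B w j) z i
        + ∑ j, B z j * spd (fun w => u w j) z i)) := by
    intro i
    rw [spd_const_mul _ (hr.fun_sub huB), spd_sub hr huB,
      spd_sum (F := fun j w => u w j * B w j) fun j _ => (hu j).mul (hB j),
      ← Finset.sum_add_distrib]
    simp only [spd_mul (hu _) (hB _)]
  have hsumflux : ∑ i, spd (energyFlux ρ μ₀ ν η p r u B i) z i
      = ρ * (∑ i, u z i * ∑ j, u z j * spd (fun w => u w j) z i) + (∑ i, u z i * spd p z i)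
        + 2 * μ₀⁻¹ * (∑ i, u z i * ∑ j, B z j * spd (fun w => B w j) z i)
        + μ₀⁻¹ * ((∑ i, B z i * spd r z i)
          - ((∑ i, B z i * ∑ j, u z j * spd (fun w => B w j) z i)
            + ∑ i, B z i * ∑ j, B z j * spd (fun w => u w j) z i))
        - (ρ * (∑ i, spd (fun w => ∑ j, 2 * ν w * sGrad u w i j * u w j) z i)
          + μ₀⁻¹ * ∑ i, spd (fun w => ∑ j, 2 * (η w / μ₀) * aGrad B w i j * B w j) z i) := by
    simp only [hflux, Finset.sum_sub_distrib, Finset.sum_add_distrib]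
    rw [sum_spd_mul_of_sdivVec_eq_zero hu hP hdivu, sum_spd_mul_of_sdivVec_eq_zero hB hQ hdivB]
    have h1 : ∀ i, u z i * spd (fun w => (2 : ℝ)⁻¹ * ρ * (∑ j, (u w j) ^ 2) + p w
        + μ₀⁻¹ * ∑ j, (B w j) ^ 2) z i
        = ρ * (u z i * ∑ j, u z j * spd (fun w => u w j) z i) + u z i * spd p z i
          + 2 * μ₀⁻¹ * (u z i * ∑ j, B z j * spd (fun w => B w j) z i) := by
      intro i
      rw [hDP]
      ring
    have h2 : ∀ i, B z i * spd (fun w => μ₀⁻¹ * (r w - ∑ j, u w j * B w j)) z i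
        = μ₀⁻¹ * (B z i * spd r z i - (B z i * (∑ j, u z j * spd (fun w => B w j) z i)
          + B z i * ∑ j, B z j * spd (fun w => u w j) z i)) := by
      intro i
      rw [hDQ]
      ring
    simp only [h1, h2, Finset.sum_sub_distrib, Finset.sum_add_distrib, ← Finset.mul_sum]
  rw [htime, hsumflux, momentum_energy_balance ρ μ₀ hρ hu hB hS hdivu hdivB hmom,
    induction_energy_balance μ₀ hu hB hA hdivu hdivB hind]
  ring

end EnergyBalance

theorem stmt_12 {d : ℕ} (hd : 1 ≤ d) (ρ μ₀ : ℝ) (hρ : 0 < ρ) (hμ₀ : 0 < μ₀)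
    (ν η : (Fin d → ℝ) × ℝ → ℝ) (hν : ContDiff ℝ 1 ν) (hη : ContDiff ℝ 1 η)
    (hν0 : ∀ z, 0 ≤ ν z) (hη0 : ∀ z, 0 ≤ η z)
    (u B : (Fin d → ℝ) × ℝ → Fin d → ℝ) (p r : (Fin d → ℝ) × ℝ → ℝ)
    (hu : ContDiff ℝ 2 u) (hB : ContDiff ℝ 2 B)
    (hp : ContDiff ℝ 1 p) (hr : ContDiff ℝ 1 r)
    -- conservation of momentum with zero forcing
    (hmom : ∀ z : (Fin d → ℝ) × ℝ, ∀ j : Fin d,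
      tpd (fun w => u w j) z
        + sdivMat (fun w i j' => u w i * u w j') z j
        + ρ⁻¹ * spd p z j
        - sdivMat (fun w i j' => 2 * ν w * sGrad u w i j') z j
        - sdivMat (fun w i j' => (ρ * μ₀)⁻¹ * (B w i * B w j'
            - (if i = j' then (2 : ℝ)⁻¹ * ∑ k, (B w k) ^ 2 else 0))) z j = 0)
    -- conservation of mass
    (hdivu : ∀ z, sdivVec u z = 0)
    -- magnetic induction equation with zero forcing
    (hind : ∀ z : (Fin d → ℝ) × ℝ, ∀ j : Fin d,
      tpd (fun w => B w j) z
        + sdivMat (fun w i j' => u w i * B w j') z j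
        - sdivMat (fun w i j' => B w i * u w j') z j
        - sdivMat (fun w i j' => 2 * (η w / μ₀) * aGrad B w i j') z j
        + spd r z j = 0)
    -- Gauss's law for magnetism
    (hdivB : ∀ z, sdivVec B z = 0)
    -- compact support in space, uniformly in time
    (K : Set (Fin d → ℝ)) (hK : IsCompact K)
    (hsupp : ∀ t : ℝ, ∀ x : Fin d → ℝ, x ∉ K →
      u (x, t) = 0 ∧ B (x, t) = 0 ∧ p (x, t) = 0 ∧ r (x, t) = 0) :
    -- the total energy is nonincreasing, with derivative the (nonpositive) dissipation
    Antitone (fun t : ℝ => ∫ x : Fin d → ℝ,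
        ((2 : ℝ)⁻¹ * ρ * (∑ j, (u (x, t) j) ^ 2)
          + (2 * μ₀)⁻¹ * (∑ j, (B (x, t) j) ^ 2))) ∧
    ∀ t : ℝ,
      HasDerivAt (fun t : ℝ => ∫ x : Fin d → ℝ,
          ((2 : ℝ)⁻¹ * ρ * (∑ j, (u (x, t) j) ^ 2)
            + (2 * μ₀)⁻¹ * (∑ j, (B (x, t) j) ^ 2)))
        (-∫ x : Fin d → ℝ,
          (2 * ρ * ν (x, t) * (∑ i, ∑ j, (sGrad u (x, t) i j) ^ 2)
            + (2 * η (x, t) / μ₀ ^ 2) * (∑ i, ∑ j, (aGrad B (x, t) i j) ^ 2))) t ∧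
      (-∫ x : Fin d → ℝ,
          (2 * ρ * ν (x, t) * (∑ i, ∑ j, (sGrad u (x, t) i j) ^ 2)
            + (2 * η (x, t) / μ₀ ^ 2) * (∑ i, ∑ j, (aGrad B (x, t) i j) ^ 2))) ≤ 0 := by
  have hu' : ∀ j, ContDiff ℝ 2 (fun w => u w j) := fun j => contDiff_pi.1 hu j
  have hB' : ∀ j, ContDiff ℝ 2 (fun w => B w j) := fun j => contDiff_pi.1 hB j
  have hu1 : ∀ j, ContDiff ℝ 1 (fun w => u w j) := fun j => (hu' j).of_le one_le_two
  have hB1 : ∀ j, ContDiff ℝ 1 (fun w => B w j) := fun j => (hB' j).of_le one_le_two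
  have hS : ∀ i j, ContDiff ℝ 1 (fun w => 2 * ν w * sGrad u w i j) := fun i j =>
    (contDiff_const.mul hν).mul (contDiff_const.mul (((hu' j).spd i).add ((hu' i).spd j)))
  have hA : ∀ i j, ContDiff ℝ 1 (fun w => 2 * (η w / μ₀) * aGrad B w i j) := fun i j =>
    (contDiff_const.mul (hη.div_const μ₀)).mul
      (contDiff_const.mul (((hB' j).spd i).sub ((hB' i).spd j)))
  have hE : ContDiff ℝ 1 (fun w => (2 : ℝ)⁻¹ * ρ * (∑ j, (u w j) ^ 2)
      + (2 * μ₀)⁻¹ * (∑ j, (B w j) ^ 2)) := by fun_prop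
  have hE0 : ∀ t : ℝ, ∀ x, x ∉ K → (2 : ℝ)⁻¹ * ρ * (∑ j, (u (x, t) j) ^ 2)
      + (2 * μ₀)⁻¹ * (∑ j, (B (x, t) j) ^ 2) = 0 := by
    intro t x hx
    obtain ⟨h1, h2, -⟩ := hsupp t x hx
    simp [h1, h2]
  have hF : ∀ i, ContDiff ℝ 1 (energyFlux ρ μ₀ ν η p r u B i) := by
    intro i
    unfold energyFlux
    fun_prop
  have hF0 : ∀ i, ∀ t : ℝ, ∀ x, x ∉ K → energyFlux ρ μ₀ ν η p r u B i (x, t) = 0 := by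
    intro i t x hx
    obtain ⟨h1, h2, -⟩ := hsupp t x hx
    simp [energyFlux, h1, h2]
  have hbal := fun z => energy_balance ρ μ₀ hρ
    (fun j => (hu1 j).differentiable one_ne_zero z) (fun j => (hB1 j).differentiable one_ne_zero z)
    (hp.differentiable one_ne_zero z) (hr.differentiable one_ne_zero z)
    (fun i j => (hS i j).differentiable one_ne_zero z)
    (fun i j => (hA i j).differentiable one_ne_zero z)
    (hdivu z) (hdivB z) (hmom z) (hind z)
  have hint : ∀ t : ℝ, (-∫ x : Fin d → ℝ,
      (2 * ρ * ν (x, t) * (∑ i, ∑ j, (sGrad u (x, t) i j) ^ 2)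
        + (2 * η (x, t) / μ₀ ^ 2) * (∑ i, ∑ j, (aGrad B (x, t) i j) ^ 2)))
      = ∫ x : Fin d → ℝ, tpd (fun w => (2 : ℝ)⁻¹ * ρ * (∑ j, (u w j) ^ 2)
        + (2 * μ₀)⁻¹ * (∑ j, (B w j) ^ 2)) (x, t) := by
    intro t
    simp only [hbal]
    rw [integral_sub (integrable_tpd hE hK hE0 t).fun_neg
        (integrable_finsetSum _ fun i _ => integrable_spd (hF i) hK (hF0 i) t i),
      integral_finsetSum _ fun i _ => integrable_spd (hF i) hK (hF0 i) t i, integral_neg]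
    simp [integral_spd_eq_zero (hF _) hK (hF0 _)]
  have hderiv := fun t => (hint t).symm ▸ hasDerivAt_integral_slice hE hK hE0 t
  have hnonpos : ∀ t : ℝ, (-∫ x : Fin d → ℝ,
      (2 * ρ * ν (x, t) * (∑ i, ∑ j, (sGrad u (x, t) i j) ^ 2)
        + (2 * η (x, t) / μ₀ ^ 2) * (∑ i, ∑ j, (aGrad B (x, t) i j) ^ 2))) ≤ 0 := by
    intro t
    refine neg_nonpos.2 (integral_nonneg fun x => ?_)
    have h1 := hν0 (x, t)
    have h2 := hη0 (x, t)
    positivity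
  refine ⟨antitone_of_deriv_nonpos (fun t => (hderiv t).differentiableAt) fun t => ?_,
    fun t => ⟨hderiv t, hnonpos t⟩⟩
  rw [(hderiv t).deriv]
  exact hnonpos t
end
end
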